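/- Let Ω ⊆ ℝ^{d₁} be an open convex set and let α : Ω → ℝ^{d₂} be piecewise linear with decomposition {(P_i, T_i, t_i)}_{i=1}^k. Then for all 1 ≤ p, q ≤ ∞, the Lipschitz norm of α over Ω equals the maximum of the induced matrix norms of the pieces: L_{p→q}(α, Ω) = max_{i=1,…,k} ‖T_i‖_{p→q}. -/

import Mathlib

open scoped ENNReal BigOperators

/-- The ℓ^p norm on `ℝ^n`, for `p : ℝ≥0∞` (with `p = ∞` giving the max norm). -/
noncomputable def lpNorm (p : ℝ≥0∞) {n : ℕ} (x : Fin n → ℝ) : ℝ :=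
  if p = ⊤ then ⨆ i, |x i| else (∑ i, |x i| ^ p.toReal) ^ (1 / p.toReal)

/-- The induced `(p → q)` operator norm of a matrix: `sup_{x ≠ 0} ‖Tx‖_q / ‖x‖_p`. -/
noncomputable def opNorm (p q : ℝ≥0∞) {m n : ℕ} (T : Matrix (Fin m) (Fin n) ℝ) : ℝ :=
  ⨆ x : {x : Fin n → ℝ // x ≠ 0}, lpNorm q (T.mulVec x.1) / lpNorm p x.1

/-- The `(p → q)` Lipschitz norm of `f` over `Ω`:
`sup_{x ≠ y ∈ Ω} ‖f x − f y‖_q / ‖x − y‖_p`. -/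
noncomputable def lipNorm (p q : ℝ≥0∞) {n m : ℕ}
    (f : (Fin n → ℝ) → (Fin m → ℝ)) (Ω : Set (Fin n → ℝ)) : ℝ :=
  sSup {r | ∃ x ∈ Ω, ∃ y ∈ Ω, x ≠ y ∧ r = lpNorm q (f x - f y) / lpNorm p (x - y)}

/-- A polyhedron in `ℝ^n`: a set of the form `{x : A x ≤ b}` (componentwise). -/
def IsPolyhedron {n : ℕ} (P : Set (Fin n → ℝ)) : Prop :=
  ∃ (r : ℕ) (A : Matrix (Fin r) (Fin n) ℝ) (b : Fin r → ℝ),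
    P = {x | ∀ i, A.mulVec x i ≤ b i}

/-- A map on a convex set that is pointwise `C`-Lipschitz near each point is `C`-Lipschitz. -/
theorem Convex.norm_sub_le_of_eventually_nhdsWithin {E F : Type*}
    [NormedAddCommGroup E] [NormedSpace ℝ E] [NormedAddCommGroup F]
    {f : E → F} {s : Set E} (hs : Convex ℝ s) {C : ℝ}
    (hf : ∀ x ∈ s, ∀ᶠ y in nhdsWithin x s, ‖f y - f x‖ ≤ C * ‖y - x‖)
    {x y : E} (hx : x ∈ s) (hy : y ∈ s) : ‖f y - f x‖ ≤ C * ‖y - x‖ := by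
  have hcont : ContinuousOn f s := by
    intro z hz
    rw [ContinuousWithinAt, tendsto_iff_norm_sub_tendsto_zero]
    refine squeeze_zero' (Filter.Eventually.of_forall fun _ => norm_nonneg _) (hf z hz) ?_
    have h : Continuous fun w : E => C * ‖w - z‖ := by fun_prop
    simpa using h.continuousWithinAt (s := s) (x := z) |>.tendsto
  let l : ℝ → E := fun a => x + a • (y - x)
  have hl : Continuous l := by fun_prop
  have hlsub : ∀ a b, l b - l a = (b - a) • (y - x) := fun a b => by
    simp only [l, sub_smul]; abel
  have hmaps : Set.MapsTo l (Set.Icc 0 1) s := fun a ha => hs.add_smul_sub_mem hx hy ha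
  have hgl : ContinuousOn (fun a => f (l a)) (Set.Icc 0 1) := hcont.comp hl.continuousOn hmaps
  let S : Set ℝ := {a | ‖f (l a) - f x‖ ≤ C * (a * ‖y - x‖)}
  have hclosed : IsClosed (S ∩ Set.Icc 0 1) := by
    rw [Set.inter_comm]
    exact isClosed_Icc.isClosed_le ((hgl.sub continuousOn_const).norm)
      (by fun_prop : Continuous fun a : ℝ => C * (a * ‖y - x‖)).continuousOn
  have hsub : Set.Icc (0 : ℝ) 1 ⊆ S := by
    refine hclosed.Icc_subset_of_forall_mem_nhdsWithin (by simp [S, l]) ?_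
    rintro a ⟨haS, ha0, ha1⟩
    have htend : Filter.Tendsto l (nhdsWithin a (Set.Ioi a)) (nhdsWithin (l a) s) := by
      refine tendsto_nhdsWithin_iff.2 ⟨hl.continuousAt.tendsto.mono_left nhdsWithin_le_nhds, ?_⟩
      filter_upwards [Ioc_mem_nhdsGT ha1] with b hb
      exact hmaps ⟨ha0.trans hb.1.le, hb.2⟩
    filter_upwards [htend.eventually (hf _ (hmaps ⟨ha0, ha1.le⟩)), self_mem_nhdsWithin]
      with b hb hab
    rw [hlsub, norm_smul, Real.norm_of_nonneg (sub_nonneg.2 (le_of_lt hab))] at hb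
    have htri := norm_sub_le_norm_sub_add_norm_sub (f (l b)) (f (l a)) (f x)
    simp only [S, Set.mem_ofPred_eq] at haS ⊢
    linarith
  simpa [S, l] using hsub (Set.right_mem_Icc.2 zero_le_one)

/-- Near any point of a finite union of closed sets, each point shares one of the sets with it. -/
theorem eventually_nhdsWithin_iUnion_exists_mem {X ι : Type*} [TopologicalSpace X] [Finite ι]
    {P : ι → Set X} (hP : ∀ i, IsClosed (P i)) (x : X) :
    ∀ᶠ y in nhdsWithin x (⋃ i, P i), ∃ i, x ∈ P i ∧ y ∈ P i := by
  have h : ∀ᶠ y in nhds x, ∀ i, x ∉ P i → y ∉ P i := by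
    refine Filter.eventually_all.2 fun i => ?_
    by_cases hx : x ∈ P i
    · exact Filter.Eventually.of_forall fun y h => absurd hx h
    · filter_upwards [(hP i).isOpen_compl.mem_nhds hx] with y hy _ using hy
  filter_upwards [nhdsWithin_le_nhds h, self_mem_nhdsWithin] with y hy hmem
  obtain ⟨i, hi⟩ := Set.mem_iUnion.1 hmem
  exact ⟨i, by_contra fun hx => hy i hx hi, hi⟩

theorem IsPolyhedron.isClosed {n : ℕ} {P : Set (Fin n → ℝ)} (hP : IsPolyhedron P) :
    IsClosed P := by
  obtain ⟨r, A, b, rfl⟩ := hP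
  simp only [Set.ofPred_forall]
  refine isClosed_iInter fun i => isClosed_le ?_ continuous_const
  exact (continuous_apply i).comp (continuous_const.matrix_mulVec continuous_id)

theorem lpNorm_eq_norm {p : ℝ≥0∞} (hp : 1 ≤ p) {n : ℕ} (x : Fin n → ℝ) :
    lpNorm p x = ‖WithLp.toLp p x‖ := by
  by_cases h : p = ⊤
  · subst h
    simp [lpNorm, PiLp.norm_eq_ciSup]
  · rw [PiLp.norm_eq_sum (ENNReal.toReal_pos (zero_lt_one.trans_le hp).ne' h)]
    simp [lpNorm, h]

theorem lpNorm_nonneg {p : ℝ≥0∞} (hp : 1 ≤ p) {n : ℕ} (x : Fin n → ℝ) : 0 ≤ lpNorm p x := by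
  have := Fact.mk hp
  exact lpNorm_eq_norm hp x ▸ norm_nonneg _

theorem lpNorm_pos {p : ℝ≥0∞} (hp : 1 ≤ p) {n : ℕ} {x : Fin n → ℝ} (hx : x ≠ 0) :
    0 < lpNorm p x := by
  have := Fact.mk hp
  rw [lpNorm_eq_norm hp, norm_pos_iff]
  simpa using hx

theorem lpNorm_smul {p : ℝ≥0∞} (hp : 1 ≤ p) {n : ℕ} (c : ℝ) (x : Fin n → ℝ) :
    lpNorm p (c • x) = |c| * lpNorm p x := by
  have := Fact.mk hp
  rw [lpNorm_eq_norm hp, lpNorm_eq_norm hp, WithLp.toLp_smul, norm_smul, Real.norm_eq_abs]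

theorem opNorm_nonneg {p q : ℝ≥0∞} (hp : 1 ≤ p) (hq : 1 ≤ q) {m n : ℕ}
    (T : Matrix (Fin m) (Fin n) ℝ) : 0 ≤ opNorm p q T :=
  Real.iSup_nonneg fun _ => div_nonneg (lpNorm_nonneg hq _) (lpNorm_nonneg hp _)

theorem lpNorm_mulVec_le {p q : ℝ≥0∞} (hp : 1 ≤ p) (hq : 1 ≤ q) {m n : ℕ}
    (T : Matrix (Fin m) (Fin n) ℝ) (x : Fin n → ℝ) :
    lpNorm q (T.mulVec x) ≤ opNorm p q T * lpNorm p x := by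
  have := Fact.mk hp
  have := Fact.mk hq
  let L : PiLp p (fun _ : Fin n => ℝ) →L[ℝ] PiLp q (fun _ : Fin m => ℝ) :=
    LinearMap.toContinuousLinearMap ((WithLp.linearEquiv q ℝ (Fin m → ℝ)).symm.toLinearMap ∘ₗ
      T.mulVecLin ∘ₗ (WithLp.linearEquiv p ℝ (Fin n → ℝ)).toLinearMap)
  have hL : ∀ z, lpNorm q (T.mulVec z) ≤ ‖L‖ * lpNorm p z := fun z => by
    rw [lpNorm_eq_norm hp, lpNorm_eq_norm hq]
    exact L.le_opNorm (WithLp.toLp p z)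
  by_cases hx : x = 0
  · subst hx
    have h0 : lpNorm p (0 : Fin n → ℝ) = 0 := by simp [lpNorm_eq_norm hp]
    simpa [h0] using hL 0
  · rw [← div_le_iff₀ (lpNorm_pos hp hx)]
    refine le_ciSup (f := fun z : {z : Fin n → ℝ // z ≠ 0} =>
      lpNorm q (T.mulVec z.1) / lpNorm p z.1) ⟨‖L‖, ?_⟩ ⟨x, hx⟩
    rintro _ ⟨z, rfl⟩
    exact (div_le_iff₀ (lpNorm_pos hp z.2)).2 (hL z.1)

/-- For an open convex `Ω ⊆ ℝ^{d₁}` and a piecewise linear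
`α : Ω → ℝ^{d₂}` with decomposition `{(P i, T i, t i)}`, for all `1 ≤ p, q ≤ ∞`,
`L_{p→q}(α, Ω) = max_i ‖T i‖_{p→q}`. -/
theorem lipNorm_eq_max_piece_opNorm
    {d₁ d₂ k : ℕ} (hk : 0 < k)
    (Ω : Set (Fin d₁ → ℝ)) (hΩopen : IsOpen Ω) (hΩconv : Convex ℝ Ω)
    (α : (Fin d₁ → ℝ) → (Fin d₂ → ℝ))
    (P : Fin k → Set (Fin d₁ → ℝ))
    (T : Fin k → Matrix (Fin d₂) (Fin d₁) ℝ)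
    (t : Fin k → Fin d₂ → ℝ)
    (hPoly : ∀ i, IsPolyhedron (P i))
    (hInt : ∀ i, (interior (P i)).Nonempty)
    (hDisj : ∀ i j, i ≠ j → interior (P i) ∩ interior (P j) = ∅)
    (hCover : (⋃ i, P i) = Ω)
    (hAff : ∀ i, ∀ x ∈ P i, α x = (T i).mulVec x + t i)
    (p q : ℝ≥0∞) (hp : 1 ≤ p) (hq : 1 ≤ q) :
    lipNorm p q α Ω = ⨆ i, opNorm p q (T i) := by
  have := Fact.mk hp
  have := Fact.mk hq
  have : Nonempty (Fin k) := ⟨⟨0, hk⟩⟩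
  have hbdd : BddAbove (Set.range fun i => opNorm p q (T i)) := (Set.finite_range _).bddAbove
  set C := ⨆ i, opNorm p q (T i)
  have hC0 : 0 ≤ C := Real.iSup_nonneg fun i => opNorm_nonneg hp hq (T i)
  have hdiff : ∀ i, ∀ x ∈ P i, ∀ y ∈ P i, α x - α y = (T i).mulVec (x - y) := by
    intro i x hx y hy
    rw [hAff i x hx, hAff i y hy, Matrix.mulVec_sub]
    abel
  have hlip : ∀ x ∈ Ω, ∀ y ∈ Ω, lpNorm q (α x - α y) ≤ C * lpNorm p (x - y) := by
    intro x hx y hy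
    let s : Set (PiLp p fun _ : Fin d₁ => ℝ) := WithLp.ofLp ⁻¹' Ω
    have hs : Convex ℝ s :=
      hΩconv.linear_preimage (WithLp.linearEquiv p ℝ (Fin d₁ → ℝ)).toLinearMap
    have key := hs.norm_sub_le_of_eventually_nhdsWithin
      (f := fun z => WithLp.toLp q (α z.ofLp)) (C := C) ?_
      (x := WithLp.toLp p y) (y := WithLp.toLp p x) hy hx
    · rwa [lpNorm_eq_norm hp, lpNorm_eq_norm hq]
    · intro z _
      have hclosed : ∀ i, IsClosed
          ((WithLp.ofLp : PiLp p (fun _ : Fin d₁ => ℝ) → _) ⁻¹' P i) :=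
        fun i => (hPoly i).isClosed.preimage (PiLp.continuous_ofLp p _)
      have hev := eventually_nhdsWithin_iUnion_exists_mem hclosed z
      rw [← Set.preimage_iUnion, hCover] at hev
      filter_upwards [hev] with w ⟨i, hz, hw⟩
      rw [← WithLp.toLp_sub, ← lpNorm_eq_norm hq, hdiff i _ hw _ hz]
      refine (lpNorm_mulVec_le hp hq _ _).trans ?_
      rw [lpNorm_eq_norm hp]
      exact mul_le_mul_of_nonneg_right (le_ciSup hbdd i) (norm_nonneg _)
  have hub : ∀ r ∈ {r | ∃ x ∈ Ω, ∃ y ∈ Ω, x ≠ y ∧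
      r = lpNorm q (α x - α y) / lpNorm p (x - y)}, r ≤ C := by
    rintro r ⟨x, hx, y, hy, hxy, rfl⟩
    exact (div_le_iff₀ (lpNorm_pos hp (sub_ne_zero.2 hxy))).2 (hlip x hx y hy)
  refine le_antisymm (Real.sSup_le hub hC0) (ciSup_le fun i => Real.iSup_le ?_ ?_)
  · rintro ⟨v, hv⟩
    obtain ⟨x, hx⟩ := hInt i
    have htend : Filter.Tendsto (fun a : ℝ => x + a • v) (nhdsWithin 0 (Set.Ioi 0)) (nhds x) := by
      have h : Continuous fun a : ℝ => x + a • v := by fun_prop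
      simpa using (h.tendsto 0).mono_left nhdsWithin_le_nhds
    obtain ⟨a, ha, ha0 : 0 < a⟩ := ((htend.eventually
      (mem_interior_iff_mem_nhds.1 hx)).and self_mem_nhdsWithin).exists
    have hxP := interior_subset hx
    have hsub : P i ⊆ Ω := hCover ▸ Set.subset_iUnion P i
    refine le_csSup ⟨C, hub⟩ ⟨x + a • v, hsub ha, x, hsub hxP, ?_, ?_⟩
    · simpa using ⟨ha0.ne', hv⟩
    · rw [hdiff i _ ha _ hxP, add_sub_cancel_left, Matrix.mulVec_smul, lpNorm_smul hp,
        lpNorm_smul hq, mul_div_mul_left _ _ (abs_pos.2 ha0.ne').ne']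
  · refine Real.sSup_nonneg ?_
    rintro r ⟨x, _, y, _, _, rfl⟩
    exact div_nonneg (lpNorm_nonneg hq _) (lpNorm_nonneg hp _)
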